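/- Let p₁, p₂ be distinct odd primes with p₁ ≡ 1 (mod 12) or p₂ ≡ 1 (mod 12), and Legendre symbol (p₁/p₂) = -1. Then the quaternion algebra ℍ[ℚ(ξ₁₂), p₁, p₂] over the 12th cyclotomic field is a division ring. -/

import Mathlib

open Complex IntermediateField Quaternion

namespace PadicInt

theorem norm_eq_one_of_toZMod_ne_zero {p : ℕ} [Fact p.Prime] {x : ℤ_[p]}
    (hx : toZMod x ≠ 0) : ‖x‖ = 1 := by
  by_contra h
  refine hx ?_
  rw [← RingHom.mem_ker, ker_toZMod]
  exact (IsLocalRing.mem_maximalIdeal x).2 (mem_nonunits.2 (lt_of_le_of_ne x.norm_le_one h))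

theorem toZMod_eq_zero_of_norm_lt_one {p : ℕ} [Fact p.Prime] {x : ℤ_[p]}
    (hx : ‖x‖ < 1) : toZMod x = 0 := by
  rw [← RingHom.mem_ker, ker_toZMod]
  exact (IsLocalRing.mem_maximalIdeal x).2 (mem_nonunits.2 hx)

theorem exists_isPrimitiveRoot {p n : ℕ} [Fact p.Prime] (hn : n ∣ p - 1) :
    ∃ z : ℤ_[p], IsPrimitiveRoot z n := by
  have hp : p.Prime := Fact.out
  have hp1 : 0 < p - 1 := Nat.sub_pos_of_lt hp.one_lt
  obtain ⟨g, hg⟩ := IsCyclic.exists_ofOrder_eq_natCard (α := (ZMod p)ˣ)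
  rw [Nat.card_eq_fintype_card, ZMod.card_units] at hg
  obtain ⟨m, hm⟩ := hn
  have hn0 : n ≠ 0 := by rintro rfl; simp [hm] at hp1
  have hroot : IsPrimitiveRoot ((g ^ m : (ZMod p)ˣ) : ZMod p) n := by
    rw [IsPrimitiveRoot.coe_units_iff]
    exact (hg ▸ IsPrimitiveRoot.orderOf g).pow (by omega) (by rw [hm, mul_comm])
  obtain ⟨a, ha⟩ := ZMod.ringHom_surjective (toZMod (p := p)) ((g ^ m : (ZMod p)ˣ) : ZMod p)
  have hna : toZMod (n : ℤ_[p]) ≠ 0 := by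
    rw [map_natCast, Ne, ZMod.natCast_eq_zero_iff]
    intro h
    have := Nat.le_of_dvd hp1 (h.trans ⟨m, hm⟩)
    omega
  have ha0 : toZMod a ≠ 0 := ha ▸ Units.ne_zero _
  have hder : ‖(Polynomial.X ^ n - 1 : Polynomial ℤ_[p]).derivative.aeval a‖ = 1 := by
    have : (Polynomial.X ^ n - 1 : Polynomial ℤ_[p]).derivative.aeval a = n * a ^ (n - 1) := by
      simp [Polynomial.derivative_X_pow]
    rw [this]
    refine norm_eq_one_of_toZMod_ne_zero ?_
    rw [map_mul, map_pow]
    exact mul_ne_zero hna (pow_ne_zero _ ha0)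
  have hval : ‖(Polynomial.X ^ n - 1 : Polynomial ℤ_[p]).aeval a‖ < 1 := by
    have : (Polynomial.X ^ n - 1 : Polynomial ℤ_[p]).aeval a = a ^ n - 1 := by simp
    rw [this, ← mem_nonunits, ← IsLocalRing.mem_maximalIdeal, ← ker_toZMod, RingHom.mem_ker,
      map_sub, map_pow, ha, hroot.pow_eq_one, map_one, sub_self]
  obtain ⟨z, hz, hza, -⟩ := hensels_lemma (F := (Polynomial.X ^ n - 1 : Polynomial ℤ_[p]))
    (a := a) (by rw [hder]; simpa using hval)
  rw [hder] at hza
  have hz1 : z ^ n = 1 := by simpa [sub_eq_zero] using hz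
  have hzmod : toZMod z = ((g ^ m : (ZMod p)ˣ) : ZMod p) := by
    rw [← ha, ← sub_eq_zero, ← map_sub, toZMod_eq_zero_of_norm_lt_one hza]
  refine ⟨z, hz1, fun l hl ↦ hroot.dvd_of_pow_eq_one l ?_⟩
  rw [← hzmod, ← map_pow, hl, map_one]

end PadicInt

namespace Padic

variable {p : ℕ} [Fact p.Prime]

theorem norm_sq_sub_of_not_isSquare {u : ℕ} (hu : ¬ IsSquare (u : ZMod p)) (t : ℚ_[p]) :
    ‖t ^ 2 - u‖ = max 1 ‖t‖ ^ 2 := by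
  rcases le_or_gt ‖t‖ 1 with ht | ht
  · rw [max_eq_left ht, one_pow]
    obtain ⟨t, rfl⟩ : ∃ r : ℤ_[p], (r : ℚ_[p]) = t := ⟨⟨t, ht⟩, rfl⟩
    have h : ‖t ^ 2 - (u : ℤ_[p])‖ = 1 := by
      refine PadicInt.norm_eq_one_of_toZMod_ne_zero fun h ↦ hu ?_
      rw [map_sub, map_pow, map_natCast, sub_eq_zero] at h
      exact ⟨_, by rw [← h, sq]⟩
    simpa [PadicInt.norm_def] using h
  · have hu1 : ‖(u : ℚ_[p])‖ ≤ 1 := by simpa using Padic.norm_int_le_one (p := p) u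
    have ht2 : 1 < ‖t ^ 2‖ := by rw [norm_pow]; exact one_lt_pow₀ ht two_ne_zero
    rw [max_eq_right ht.le, sub_eq_add_neg, add_eq_max_of_ne (by rw [norm_neg]; linarith),
      norm_neg, max_eq_left (by linarith), norm_pow]

theorem exists_norm_sq_sub_mul_sq_eq {u : ℕ} (hu : ¬ IsSquare (u : ZMod p)) (a b : ℚ_[p]) :
    ∃ s : ℚ_[p], ‖a ^ 2 - u * b ^ 2‖ = ‖s‖ ^ 2 ∧ (s = 0 → a = 0 ∧ b = 0) := by
  rcases eq_or_ne b 0 with rfl | hb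
  · exact ⟨a, by simp, fun h ↦ ⟨h, rfl⟩⟩
  have key : ‖a ^ 2 - u * b ^ 2‖ = (max 1 ‖a / b‖ * ‖b‖) ^ 2 := by
    rw [mul_pow, ← norm_sq_sub_of_not_isSquare hu, ← norm_pow, ← norm_mul]
    congr 1
    field_simp
  rcases le_total ‖a / b‖ 1 with h | h
  · exact ⟨b, by rw [key, max_eq_left h, one_mul], fun h0 ↦ absurd h0 hb⟩
  · refine ⟨a, by rw [key, max_eq_right h, ← norm_mul, div_mul_cancel₀ _ hb], ?_⟩
    rintro rfl
    simp at h
    linarith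

theorem norm_sq_ne_norm_p_mul_norm_sq {s t : ℚ_[p]} (ht : t ≠ 0) :
    ‖s‖ ^ 2 ≠ ‖(p : ℚ_[p])‖ * ‖t‖ ^ 2 := by
  have hp : p.Prime := Fact.out
  intro h
  have hs : s ≠ 0 := by
    rintro rfl
    simp [ht, hp.ne_zero] at h
  have hpR : (0 : ℝ) < p := by exact_mod_cast hp.pos
  have hpR1 : (p : ℝ) ≠ 1 := by exact_mod_cast hp.ne_one
  rw [norm_p, norm_eq_zpow_neg_valuation hs, norm_eq_zpow_neg_valuation ht, ← zpow_natCast,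
    ← zpow_natCast, ← zpow_mul, ← zpow_mul, ← zpow_neg_one, ← zpow_add₀ hpR.ne',
    zpow_right_inj₀ hpR hpR1] at h
  push_cast at h
  omega

/-- If `u` is a quadratic nonresidue modulo `p`, then the norm form of the quaternion algebra
`(u, p)` is anisotropic over `ℚ_[p]`. -/
theorem quaternion_norm_form_anisotropic {u : ℕ} (hu : ¬ IsSquare (u : ZMod p))
    {a b c d : ℚ_[p]} (h : a ^ 2 - u * b ^ 2 - p * c ^ 2 + u * p * d ^ 2 = 0) :
    a = 0 ∧ b = 0 ∧ c = 0 ∧ d = 0 := by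
  obtain ⟨s, hs, hs0⟩ := exists_norm_sq_sub_mul_sq_eq hu a b
  obtain ⟨t, ht, ht0⟩ := exists_norm_sq_sub_mul_sq_eq hu c d
  have heq : a ^ 2 - u * b ^ 2 = p * (c ^ 2 - u * d ^ 2) := by linear_combination h
  have hn : ‖s‖ ^ 2 = ‖(p : ℚ_[p])‖ * ‖t‖ ^ 2 := by rw [← hs, ← ht, heq, norm_mul]
  have htz : t = 0 := by
    by_contra htne
    exact norm_sq_ne_norm_p_mul_norm_sq htne hn
  have hsz : s = 0 := by simpa [htz] using hn
  exact ⟨(hs0 hsz).1, (hs0 hsz).2, (ht0 htz).1, (ht0 htz).2⟩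

end Padic

theorem IsPrimitiveRoot.exists_algHom_adjoin {L E : Type*} [Field L] [CharZero L] [Field E]
    [CharZero E] {n : ℕ} (hn : 0 < n) {ζ : L} (hζ : IsPrimitiveRoot ζ n) {z : E}
    (hz : IsPrimitiveRoot z n) : Nonempty (IntermediateField.adjoin ℚ {ζ} →ₐ[ℚ] E) := by
  have hint : IsIntegral ℚ ζ := (hζ.isIntegral hn).tower_top
  refine ⟨(IntermediateField.adjoin.powerBasis hint).lift z ?_⟩
  rw [IntermediateField.adjoin.powerBasis_gen, IntermediateField.minpoly_gen,
    ← Polynomial.cyclotomic_eq_minpoly_rat hζ hn, Polynomial.aeval_def, Polynomial.eval₂_eq_eval_map,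
    Polynomial.map_cyclotomic]
  exact hz.isRoot_cyclotomic hn

theorem IsPrimitiveRoot.exists_algHom_adjoin_padic {L : Type*} [Field L] [CharZero L]
    {n p : ℕ} [Fact p.Prime] (hn : n ∣ p - 1) {ζ : L} (hζ : IsPrimitiveRoot ζ n) :
    Nonempty (IntermediateField.adjoin ℚ {ζ} →ₐ[ℚ] ℚ_[p]) := by
  have hn0 : 0 < n := Nat.pos_of_dvd_of_pos hn (Nat.sub_pos_of_lt (Fact.out : p.Prime).one_lt)
  obtain ⟨z, hz⟩ := PadicInt.exists_isPrimitiveRoot hn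
  exact hζ.exists_algHom_adjoin hn0
    (hz.map_of_injective (f := PadicInt.Coe.ringHom) Subtype.coe_injective)

theorem QuaternionAlgebra.isUnit_of_norm_form_ne_zero {K : Type*} [Field K] {u v : K}
    {x : ℍ[K, u, v]}
    (h : x.re ^ 2 - u * x.imI ^ 2 - v * x.imJ ^ 2 + u * v * x.imK ^ 2 ≠ 0) : IsUnit x := by
  have hre : (x * star x).re =
      x.re ^ 2 - u * x.imI ^ 2 - v * x.imJ ^ 2 + u * v * x.imK ^ 2 := by
    simp
    ring
  have hx : IsUnit (x * star x) := by
    rw [QuaternionAlgebra.mul_star_eq_coe, hre]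
    exact (IsUnit.mk0 _ h).map (algebraMap K ℍ[K, u, v])
  have hcomm : Commute x (star x) := by
    have : star x = ((2 * x.re : K) : ℍ[K, u, v]) - x := by
      ext <;> (simp; try ring)
    rw [this]
    exact (QuaternionAlgebra.coe_commute _ _).symm.sub_right (Commute.refl x)
  exact (hcomm.isUnit_mul_iff.1 hx).1

theorem division_quaternion_over_twelfth_cyclotomic (p₁ p₂ : ℕ)
    (hp₁ : p₁.Prime) (hp₂ : p₂.Prime) (hodd₁ : Odd p₁) (hodd₂ : Odd p₂)
    (hne : p₁ ≠ p₂) (hmod : p₁ % 12 = 1 ∨ p₂ % 12 = 1)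
    (hleg : @legendreSym p₂ ⟨hp₂⟩ p₁ = -1) :
    let K : IntermediateField ℚ ℂ :=
      IntermediateField.adjoin ℚ {Complex.exp (2 * Real.pi * Complex.I / 12)}
    ∀ x : ℍ[↥K, (p₁ : ↥K), (p₂ : ↥K)], x ≠ 0 → IsUnit x := by
  intro K x hx
  have : Fact p₁.Prime := ⟨hp₁⟩
  have : Fact p₂.Prime := ⟨hp₂⟩
  have hζ : IsPrimitiveRoot (Complex.exp (2 * Real.pi * Complex.I / 12)) 12 := by
    simpa using Complex.isPrimitiveRoot_exp 12 (by norm_num)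
  refine QuaternionAlgebra.isUnit_of_norm_form_ne_zero fun h ↦ hx ?_
  suffices x.re = 0 ∧ x.imI = 0 ∧ x.imJ = 0 ∧ x.imK = 0 from
    QuaternionAlgebra.ext this.1 this.2.1 this.2.2.1 this.2.2.2
  rcases hmod with hmod | hmod
  · have hleg' : legendreSym p₁ p₂ = -1 := by
      rw [← hleg]
      exact (legendreSym.quadratic_reciprocity_one_mod_four (by omega)
        (by rintro rfl; exact absurd hodd₂ (by decide))).symm
    have hsq : ¬ IsSquare (p₂ : ZMod p₁) := by
      simpa using (legendreSym.eq_neg_one_iff p₁).1 hleg'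
    obtain ⟨φ⟩ := hζ.exists_algHom_adjoin_padic (p := p₁) (by omega)
    have h' := congrArg φ h
    simp only [map_add, map_sub, map_mul, map_pow, map_natCast, map_zero] at h'
    have := Padic.quaternion_norm_form_anisotropic hsq (a := φ x.re) (b := φ x.imJ)
      (c := φ x.imI) (d := φ x.imK) (by linear_combination h')
    simp only [map_eq_zero] at this
    tauto
  · have hsq : ¬ IsSquare (p₁ : ZMod p₂) := by
      simpa using (legendreSym.eq_neg_one_iff p₂).1 hleg
    obtain ⟨φ⟩ := hζ.exists_algHom_adjoin_padic (p := p₂) (by omega)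
    have h' := congrArg φ h
    simp only [map_add, map_sub, map_mul, map_pow, map_natCast, map_zero] at h'
    have := Padic.quaternion_norm_form_anisotropic hsq h'
    simpa only [map_eq_zero] using this
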